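/- arXiv:2206.05664 — 3 statements merged into one kernel-verified Lean document; each statement's English description precedes it below -/
import Mathlib

section
/- Suppose f(x̂) > 0 and ε > 0, and let g(r) = Σᵢ λᵢ yᵢ K(x̂ + r, xᵢ) be differentiable at r̄ ∈ ℝ^d with gradient ∇g(r̄). If (r̄, μ̄) ∈ ℝ^d × ℝ satisfies the KKT conditions 2r̄ + μ̄ ∇g(r̄) = 0, μ̄ (g(r̄) + b + ε) = 0, μ̄ ≥ 0, and g(r̄) + b + ε ≤ 0, then μ̄ > 0. -/
/-- If `f(x̂) > 0`, `ε > 0`, `g` has gradient `∇g(r̄)` at `r̄`, and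
`(r̄, μ̄)` satisfies the KKT conditions, then `μ̄ > 0`. -/
theorem stmt3 {d m : ℕ} (x : Fin m → EuclideanSpace ℝ (Fin d))
    (y : Fin m → ℝ) (hy : ∀ i, y i = -1 ∨ y i = 1)
    (lam : Fin m → ℝ) (hlam : ∀ i, 0 ≤ lam i) (b : ℝ)
    (K : EuclideanSpace ℝ (Fin d) → EuclideanSpace ℝ (Fin d) → ℝ)
    (f : EuclideanSpace ℝ (Fin d) → ℝ)
    (hf : ∀ z, f z = (∑ i, lam i * y i * K z (x i)) + b)
    (xhat : EuclideanSpace ℝ (Fin d)) (hfx : 0 < f xhat)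
    (ε : ℝ) (hε : 0 < ε)
    (g : EuclideanSpace ℝ (Fin d) → ℝ)
    (hg : ∀ r, g r = ∑ i, lam i * y i * K (xhat + r) (x i))
    (rbar : EuclideanSpace ℝ (Fin d)) (gradg : EuclideanSpace ℝ (Fin d))
    (hgrad : HasGradientAt g gradg rbar)
    (mubar : ℝ)
    (hstat : (2 : ℝ) • rbar + mubar • gradg = 0)
    (hcomp : mubar * (g rbar + b + ε) = 0)
    (hmu : 0 ≤ mubar)
    (hfeas : g rbar + b + ε ≤ 0) :
    0 < mubar := by
  refine lt_of_le_of_ne hmu fun h => ?_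
  subst h
  have hr : rbar = 0 := by simpa using hstat
  have hfg : f xhat = g rbar + b := by rw [hf, hg, hr, add_zero]
  linarith
end

section
/- (LICQ at KKT points.) Suppose f(x̂) > 0 and ε > 0, and let g(r) = Σᵢ λᵢ yᵢ K(x̂ + r, xᵢ) be differentiable at r̄ ∈ ℝ^d with gradient ∇g(r̄). If (r̄, μ̄) ∈ ℝ^d × ℝ satisfies the KKT conditions 2r̄ + μ̄ ∇g(r̄) = 0, μ̄ (g(r̄) + b + ε) = 0, μ̄ ≥ 0, and g(r̄) + b + ε ≤ 0, then r̄ ≠ 0 and ∇g(r̄) ≠ 0 (i.e., the linear independence constraint qualification holds at r̄). -/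
/-- LICQ at KKT points: if `f(x̂) > 0`, `ε > 0`, and `(r̄, μ̄)`
satisfies the KKT conditions, then `r̄ ≠ 0` and `∇g(r̄) ≠ 0`. -/
theorem stmt5 {d m : ℕ} (x : Fin m → EuclideanSpace ℝ (Fin d))
    (y : Fin m → ℝ) (hy : ∀ i, y i = -1 ∨ y i = 1)
    (lam : Fin m → ℝ) (hlam : ∀ i, 0 ≤ lam i) (b : ℝ)
    (K : EuclideanSpace ℝ (Fin d) → EuclideanSpace ℝ (Fin d) → ℝ)
    (f : EuclideanSpace ℝ (Fin d) → ℝ)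
    (hf : ∀ z, f z = (∑ i, lam i * y i * K z (x i)) + b)
    (xhat : EuclideanSpace ℝ (Fin d)) (hfx : 0 < f xhat)
    (ε : ℝ) (hε : 0 < ε)
    (g : EuclideanSpace ℝ (Fin d) → ℝ)
    (hg : ∀ r, g r = ∑ i, lam i * y i * K (xhat + r) (x i))
    (rbar : EuclideanSpace ℝ (Fin d)) (gradg : EuclideanSpace ℝ (Fin d))
    (hgrad : HasGradientAt g gradg rbar)
    (mubar : ℝ)
    (hstat : (2 : ℝ) • rbar + mubar • gradg = 0)
    (hcomp : mubar * (g rbar + b + ε) = 0)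
    (hmu : 0 ≤ mubar)
    (hfeas : g rbar + b + ε ≤ 0) :
    rbar ≠ 0 ∧ gradg ≠ 0 := by
  have hr : rbar ≠ 0 := by
    rintro rfl
    have hg0 := hg 0
    rw [add_zero] at hg0
    linarith [hf xhat]
  refine ⟨hr, ?_⟩
  rintro rfl
  exact hr (by simpa using hstat)
end

section
/- (LICQ, negative-class case.) Suppose f(x̂) < 0 and ε > 0, and let g(r) = Σᵢ λᵢ yᵢ K(x̂ + r, xᵢ) be differentiable at r̄ ∈ ℝ^d with gradient ∇g(r̄). If (r̄, μ̄) ∈ ℝ^d × ℝ satisfies the KKT conditions 2r̄ − μ̄ ∇g(r̄) = 0, μ̄ (−g(r̄) − b + ε) = 0, μ̄ ≥ 0, and −g(r̄) − b + ε ≤ 0, then r̄ ≠ 0 and ∇g(r̄) ≠ 0 (i.e., the linear independence constraint qualification holds at r̄). -/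
/-- LICQ, negative-class case: if `f(x̂) < 0`, `ε > 0` and
`(r̄, μ̄)` satisfies the negative-class KKT conditions, then `r̄ ≠ 0` and
`∇g(r̄) ≠ 0`. -/
theorem stmt11 {d m : ℕ} (x : Fin m → EuclideanSpace ℝ (Fin d))
    (y : Fin m → ℝ) (hy : ∀ i, y i = -1 ∨ y i = 1)
    (lam : Fin m → ℝ) (hlam : ∀ i, 0 ≤ lam i) (b : ℝ)
    (K : EuclideanSpace ℝ (Fin d) → EuclideanSpace ℝ (Fin d) → ℝ)
    (f : EuclideanSpace ℝ (Fin d) → ℝ)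
    (hf : ∀ z, f z = (∑ i, lam i * y i * K z (x i)) + b)
    (xhat : EuclideanSpace ℝ (Fin d)) (hfx : f xhat < 0)
    (ε : ℝ) (hε : 0 < ε)
    (g : EuclideanSpace ℝ (Fin d) → ℝ)
    (hg : ∀ r, g r = ∑ i, lam i * y i * K (xhat + r) (x i))
    (rbar : EuclideanSpace ℝ (Fin d)) (gradg : EuclideanSpace ℝ (Fin d))
    (hgrad : HasGradientAt g gradg rbar)
    (mubar : ℝ)
    (hstat : (2 : ℝ) • rbar - mubar • gradg = 0)
    (hcomp : mubar * (-g rbar - b + ε) = 0)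
    (hmu : 0 ≤ mubar)
    (hfeas : -g rbar - b + ε ≤ 0) :
    rbar ≠ 0 ∧ gradg ≠ 0 := by
  have hr : rbar ≠ 0 := by
    rintro rfl
    have h := hf xhat
    rw [hg 0, add_zero] at hfeas
    linarith
  refine ⟨hr, ?_⟩
  rintro rfl
  exact hr (by simpa using hstat)
end
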